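/- arXiv:1805.04480 — 2 statements merged into one kernel-verified Lean document; each statement's English description precedes it below -/
import Mathlib

section
/- Let ξ = Σ_{k=1}^∞ 10^{−k!} be Liouville's constant and set ξ₁ = ξ and ξ₂ = ξ². Then φ̲₁ = −2, φ̲₂ = −1/2, φ̲₃ = 0, φ̄₁ = 0, φ̄₂ = 1, and φ̄₃ = 1. -/
open Filter Pointwise

/-- The lattice `Λ = {(x, ξ₁x - y₁, ξ₂x - y₂) : x, y₁, y₂ ∈ ℤ} ⊆ ℝ³`. -/
def LatticeSet (ξ₁ ξ₂ : ℝ) : Set (Fin 3 → ℝ) :=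
  {p | ∃ x y₁ y₂ : ℤ, p 0 = (x : ℝ) ∧ p 1 = ξ₁ * x - y₁ ∧ p 2 = ξ₂ * x - y₂}

/-- The box `K(q) = {(z₀,z₁,z₂) : |z₀| ≤ e^{2q}, |z₁| ≤ e^{-q}, |z₂| ≤ e^{-q}}`. -/
def Box (q : ℝ) : Set (Fin 3 → ℝ) :=
  {z | |z 0| ≤ Real.exp (2 * q) ∧ |z 1| ≤ Real.exp (-q) ∧ |z 2| ≤ Real.exp (-q)}

/-- The `j`-th successive minimum `λ_j(q)` of `K(q)` with respect to `Λ`: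
the infimum of all `λ > 0` such that `λ·K(q)` contains `j` linearly independent
points of `Λ`. -/
noncomputable def lambdaMin (ξ₁ ξ₂ : ℝ) (j : ℕ) (q : ℝ) : ℝ :=
  sInf {l : ℝ | 0 < l ∧ ∃ v : Fin j → (Fin 3 → ℝ), LinearIndependent ℝ v ∧
    ∀ i, v i ∈ LatticeSet ξ₁ ξ₂ ∧ v i ∈ l • Box q}

/-- `L_j(q) = log λ_j(q)`. -/
noncomputable def Lmin (ξ₁ ξ₂ : ℝ) (j : ℕ) (q : ℝ) : ℝ :=
  Real.log (lambdaMin ξ₁ ξ₂ j q)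

/-- `φ̲_j = liminf_{q → ∞} L_j(q)/q`. -/
noncomputable def phiLow (ξ₁ ξ₂ : ℝ) (j : ℕ) : ℝ :=
  liminf (fun q : ℝ => Lmin ξ₁ ξ₂ j q / q) atTop

/-- `φ̄_j = limsup_{q → ∞} L_j(q)/q`. -/
noncomputable def phiUp (ξ₁ ξ₂ : ℝ) (j : ℕ) : ℝ :=
  limsup (fun q : ℝ => Lmin ξ₁ ξ₂ j q / q) atTop

/-- `v` lies in the dilated box `l • Box q`, in coordinates. -/
def InBox (l q : ℝ) (v : Fin 3 → ℝ) : Prop :=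
  |v 0| ≤ l * Real.exp (2 * q) ∧ |v 1| ≤ l * Real.exp (-q) ∧ |v 2| ≤ l * Real.exp (-q)

lemma mem_smul_Box {l q : ℝ} (hl : 0 < l) {v : Fin 3 → ℝ} : v ∈ l • Box q ↔ InBox l q v := by
  rw [Set.mem_smul_set_iff_inv_smul_mem₀ hl.ne']
  simp only [Box, InBox, Set.mem_ofPred_eq, Pi.smul_apply, smul_eq_mul, abs_mul, abs_inv,
    abs_of_pos hl, inv_mul_le_iff₀ hl]

/-- The lattice point with integer coordinates `x`, `y₁`, `y₂`. -/
def latticePt (ξ₁ ξ₂ : ℝ) (x y₁ y₂ : ℤ) : Fin 3 → ℝ := ![x, ξ₁ * x - y₁, ξ₂ * x - y₂]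

lemma latticePt_mem (ξ₁ ξ₂ : ℝ) (x y₁ y₂ : ℤ) :
    latticePt ξ₁ ξ₂ x y₁ y₂ ∈ LatticeSet ξ₁ ξ₂ :=
  ⟨x, y₁, y₂, by simp [latticePt], by simp [latticePt], by simp [latticePt]⟩

lemma exists_eq_latticePt {ξ₁ ξ₂ : ℝ} {v : Fin 3 → ℝ} (hv : v ∈ LatticeSet ξ₁ ξ₂) :
    ∃ x y₁ y₂ : ℤ, v = latticePt ξ₁ ξ₂ x y₁ y₂ := by
  obtain ⟨x, y₁, y₂, h0, h1, h2⟩ := hv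
  refine ⟨x, y₁, y₂, ?_⟩
  ext i
  fin_cases i <;> simp [latticePt, h0, h1, h2]

lemma one_le_abs_intCast {n : ℤ} (hn : n ≠ 0) : (1 : ℝ) ≤ |(n : ℝ)| := by
  exact_mod_cast Int.one_le_abs hn

lemma det_latticePt (ξ₁ ξ₂ : ℝ) (x y z : Fin 3 → ℤ) :
    (Matrix.of fun i => latticePt ξ₁ ξ₂ (x i) (y i) (z i)).det =
      ((x 0 * (y 1 * z 2 - y 2 * z 1) - x 1 * (y 0 * z 2 - y 2 * z 0) +
        x 2 * (y 0 * z 1 - y 1 * z 0) : ℤ) : ℝ) := by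
  simp [Matrix.det_fin_three, latticePt]
  ring

lemma one_le_of_det_ne_zero {ξ₁ ξ₂ q : ℝ} {l : Fin 3 → ℝ} (hl : ∀ i, 0 < l i)
    {v : Fin 3 → Fin 3 → ℝ} (hv : ∀ i, v i ∈ LatticeSet ξ₁ ξ₂) (hb : ∀ i, InBox (l i) q (v i))
    (hd : (Matrix.of v).det ≠ 0) : 1 ≤ 6 * (l 0 * l 1 * l 2) := by
  choose x y z h using fun i => exists_eq_latticePt (hv i)
  have hone : 1 ≤ |(Matrix.of v).det| := by
    have hv' : v = fun i => latticePt ξ₁ ξ₂ (x i) (y i) (z i) := funext h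
    rw [hv', det_latticePt] at hd ⊢
    exact one_le_abs_intCast (by exact_mod_cast hd)
  have hexp : Real.exp (2 * q) * Real.exp (-q) * Real.exp (-q) = 1 := by
    rw [← Real.exp_add, ← Real.exp_add, Real.exp_eq_one_iff]; ring
  have hterm : ∀ i j k : Fin 3, |v i 0 * v j 1 * v k 2| ≤ l i * l j * l k := by
    intro i j k
    have hi := (hb i).1
    have hj := (hb j).2.1
    have hk := (hb k).2.2
    have := (hl i).le
    have := (hl j).le
    calc |v i 0 * v j 1 * v k 2| = |v i 0| * |v j 1| * |v k 2| := by rw [abs_mul, abs_mul]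
      _ ≤ (l i * Real.exp (2 * q)) * (l j * Real.exp (-q)) * (l k * Real.exp (-q)) := by gcongr
      _ = l i * l j * l k * (Real.exp (2 * q) * Real.exp (-q) * Real.exp (-q)) := by ring
      _ = l i * l j * l k := by rw [hexp, mul_one]
  have h1 := abs_le.1 (hterm 0 1 2)
  have h2 := abs_le.1 (hterm 0 2 1)
  have h3 := abs_le.1 (hterm 1 0 2)
  have h4 := abs_le.1 (hterm 1 2 0)
  have h5 := abs_le.1 (hterm 2 0 1)
  have h6 := abs_le.1 (hterm 2 1 0)
  refine hone.trans (abs_le.2 ?_)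
  rw [Matrix.det_fin_three]
  simp only [Matrix.of_apply]
  constructor <;> nlinarith

lemma det_ne_zero_of_linearIndependent {v : Fin 3 → Fin 3 → ℝ} (hv : LinearIndependent ℝ v) :
    (Matrix.of v).det ≠ 0 := by
  have : LinearIndependent ℝ (Matrix.of v).row := hv
  rw [Matrix.linearIndependent_rows_iff_isUnit, Matrix.isUnit_iff_isUnit_det] at this
  exact this.ne_zero

lemma exists_det_updateRow_ne_zero {v : Fin 3 → Fin 3 → ℝ} (hv : (Matrix.of v).det ≠ 0)
    {u : Fin 3 → ℝ} (hu : u ≠ 0) : ∃ i, (Matrix.of (Function.update v i u)).det ≠ 0 := by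
  by_contra! h
  have hc : Matrix.cramer (Matrix.of v).transpose u = 0 := by
    ext i
    rw [Matrix.cramer_transpose_apply]
    exact h i
  have := Matrix.mulVec_cramer (Matrix.of v).transpose u
  rw [hc, Matrix.mulVec_zero, Matrix.det_transpose] at this
  exact (smul_ne_zero hv hu) this.symm

lemma exp_neg_two_mul_le {ξ₁ ξ₂ l q : ℝ} (hq : 0 ≤ q) (hl : 0 < l) {v : Fin 3 → ℝ}
    (hv : v ∈ LatticeSet ξ₁ ξ₂) (hb : InBox l q v) (h0 : v ≠ 0) : Real.exp (-(2 * q)) ≤ l := by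
  have key : 1 ≤ l * Real.exp (2 * q) := by
    obtain ⟨x, y, z, rfl⟩ := exists_eq_latticePt hv
    have hle : l * Real.exp (-q) ≤ l * Real.exp (2 * q) := by gcongr; linarith
    obtain ⟨b0, b1, b2⟩ := hb
    simp only [latticePt, Matrix.cons_val] at b0 b1 b2
    by_cases hx : x = 0
    · subst hx
      simp only [Int.cast_zero, mul_zero, zero_sub, abs_neg] at b1 b2
      by_cases hy : y = 0
      · have hz : z ≠ 0 := by
          rintro rfl
          subst hy
          exact h0 (by ext i; fin_cases i <;> simp [latticePt])
        linarith [one_le_abs_intCast hz]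
      · linarith [one_le_abs_intCast hy]
    · linarith [one_le_abs_intCast hx]
  rw [Real.exp_neg, inv_le_iff_one_le_mul₀ (Real.exp_pos _)]
  exact key

section SuccessiveMinima

variable {ξ₁ ξ₂ q t : ℝ} {j : ℕ}

lemma exp_neg_two_mul_le_of_mem (hj : 1 ≤ j) (hq : 0 ≤ q) {l : ℝ}
    (h : l ∈ {l : ℝ | 0 < l ∧ ∃ v : Fin j → (Fin 3 → ℝ), LinearIndependent ℝ v ∧
      ∀ i, v i ∈ LatticeSet ξ₁ ξ₂ ∧ v i ∈ l • Box q}) : Real.exp (-(2 * q)) ≤ l := by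
  obtain ⟨hl, v, hli, hv⟩ := h
  have : NeZero j := ⟨by omega⟩
  exact exp_neg_two_mul_le hq hl (hv 0).1 ((mem_smul_Box hl).1 (hv 0).2) (hli.ne_zero 0)

lemma Lmin_le (hj : 1 ≤ j) (hq : 0 ≤ q) {v : Fin j → Fin 3 → ℝ} (hli : LinearIndependent ℝ v)
    (hv : ∀ i, v i ∈ LatticeSet ξ₁ ξ₂) (hb : ∀ i, InBox (Real.exp t) q (v i)) :
    Lmin ξ₁ ξ₂ j q ≤ t := by
  have hmem : Real.exp t ∈ {l : ℝ | 0 < l ∧ ∃ v : Fin j → (Fin 3 → ℝ), LinearIndependent ℝ v ∧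
      ∀ i, v i ∈ LatticeSet ξ₁ ξ₂ ∧ v i ∈ l • Box q} :=
    ⟨Real.exp_pos t, v, hli, fun i => ⟨hv i, (mem_smul_Box (Real.exp_pos t)).2 (hb i)⟩⟩
  have hpos : 0 < lambdaMin ξ₁ ξ₂ j q :=
    (Real.exp_pos (-(2 * q))).trans_le
      (le_csInf ⟨_, hmem⟩ fun l hl => exp_neg_two_mul_le_of_mem hj hq hl)
  have hle : lambdaMin ξ₁ ξ₂ j q ≤ Real.exp t :=
    csInf_le ⟨_, fun l hl => exp_neg_two_mul_le_of_mem hj hq hl⟩ hmem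
  exact (Real.log_le_iff_le_exp hpos).2 hle

lemma Lmin_le_of_triple (hj : 1 ≤ j) (hj3 : j ≤ 3) (hq : 0 ≤ q) {v : Fin 3 → Fin 3 → ℝ}
    (hd : (Matrix.of v).det ≠ 0) (hv : ∀ i, v i ∈ LatticeSet ξ₁ ξ₂)
    (hb : ∀ i : Fin j, InBox (Real.exp t) q (v (Fin.castLE hj3 i))) :
    Lmin ξ₁ ξ₂ j q ≤ t :=
  Lmin_le hj hq (v := v ∘ Fin.castLE hj3)
    ((Matrix.linearIndependent_rows_of_det_ne_zero hd).comp _ (Fin.castLE_injective hj3))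
    (fun _ => hv _) hb

variable (ξ₁ ξ₂) in
lemma exists_triple_inBox_exp (hq : 0 ≤ q) : ∃ v : Fin 3 → Fin 3 → ℝ, (Matrix.of v).det ≠ 0 ∧
    (∀ i, v i ∈ LatticeSet ξ₁ ξ₂) ∧ ∀ i, InBox (Real.exp q) q (v i) := by
  refine ⟨fun i => latticePt ξ₁ ξ₂ (![1, 0, 0] i) (![⌊ξ₁⌋, 1, 0] i) (![⌊ξ₂⌋, 0, 1] i), ?_,
    fun i => latticePt_mem _ _ _ _ _, ?_⟩
  · rw [det_latticePt]
    simp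
  · have h1 : 1 ≤ Real.exp q * Real.exp (2 * q) := by
      rw [← Real.exp_add]; exact Real.one_le_exp (by linarith)
    have h2 : Real.exp q * Real.exp (-q) = 1 := by rw [← Real.exp_add]; simp
    intro i
    unfold InBox
    rw [h2]
    have a1 := abs_of_nonneg (Int.fract_nonneg ξ₁)
    have a2 := abs_of_nonneg (Int.fract_nonneg ξ₂)
    have b1 := (Int.fract_lt_one ξ₁).le
    have b2 := (Int.fract_lt_one ξ₂).le
    fin_cases i <;> simp [latticePt, a1, a2, b1, b2, h1] <;> positivity

lemma Lmin_le_self (hj : 1 ≤ j) (hj3 : j ≤ 3) (hq : 0 ≤ q) : Lmin ξ₁ ξ₂ j q ≤ q := by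
  obtain ⟨v, hd, hv, hb⟩ := exists_triple_inBox_exp ξ₁ ξ₂ hq
  exact Lmin_le_of_triple hj hj3 hq hd hv fun _ => hb _

lemma le_Lmin (hj3 : j ≤ 3) (hq : 0 ≤ q)
    (h : ∀ l : ℝ, 0 < l → ∀ v : Fin j → Fin 3 → ℝ, LinearIndependent ℝ v →
      (∀ i, v i ∈ LatticeSet ξ₁ ξ₂) → (∀ i, InBox l q (v i)) → Real.exp t ≤ l) :
    t ≤ Lmin ξ₁ ξ₂ j q := by
  have hle : Real.exp t ≤ lambdaMin ξ₁ ξ₂ j q := by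
    refine le_csInf ?_ ?_
    · obtain ⟨v, hd, hv, hb⟩ := exists_triple_inBox_exp ξ₁ ξ₂ hq
      exact ⟨Real.exp q, Real.exp_pos q, v ∘ Fin.castLE hj3,
        (Matrix.linearIndependent_rows_of_det_ne_zero hd).comp _ (Fin.castLE_injective hj3),
        fun i => ⟨hv _, (mem_smul_Box (Real.exp_pos q)).2 (hb _)⟩⟩
    · rintro l ⟨hl, v, hli, hv⟩
      exact h l hl v hli (fun i => (hv i).1) fun i => (mem_smul_Box hl).1 (hv i).2
  exact (Real.le_log_iff_exp_le ((Real.exp_pos t).trans_le hle)).2 hle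

lemma neg_two_mul_le_Lmin_one (hq : 0 ≤ q) : -(2 * q) ≤ Lmin ξ₁ ξ₂ 1 q :=
  le_Lmin (by norm_num) hq fun _ hl _ hli hv hb =>
    exp_neg_two_mul_le hq hl (hv 0) (hb 0) (hli.ne_zero 0)

lemma seven_le_exp_two : (7 : ℝ) ≤ Real.exp 2 := by
  have h := Real.exp_one_gt_d9
  have : Real.exp 2 = Real.exp 1 * Real.exp 1 := by rw [← Real.exp_add]; norm_num
  nlinarith

lemma neg_two_le_Lmin_three (hq : 0 ≤ q) : -2 ≤ Lmin ξ₁ ξ₂ 3 q := by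
  refine le_Lmin le_rfl hq fun l hl v hli hv hb => ?_
  have h := one_le_of_det_ne_zero (l := fun _ => l) (fun _ => hl) hv hb
    (det_ne_zero_of_linearIndependent hli)
  by_contra! hlt
  rw [Real.exp_neg] at hlt
  have h7 : l < 1 / 7 := hlt.trans_le (by
    rw [one_div]; exact inv_anti₀ (by norm_num) seven_le_exp_two)
  have : l * l * l < 1 / 7 * (1 / 7) * (1 / 7) := by gcongr
  norm_num at this
  linarith

lemma neg_half_le_Lmin_two (hq : 0 ≤ q) : -(q / 2) - 1 ≤ Lmin ξ₁ ξ₂ 2 q := by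
  refine le_Lmin (by norm_num) hq fun l hl v hli hv hb => ?_
  obtain ⟨x, y, z, hu⟩ := exists_eq_latticePt (hv 0)
  obtain ⟨x', y', z', hw⟩ := exists_eq_latticePt (hv 1)
  have hb0 := hb 0
  have hb1 := hb 1
  rw [hu] at hb0
  rw [hw] at hb1
  obtain ⟨a0, a1, a2⟩ := hb0
  obtain ⟨b0, b1, b2⟩ := hb1
  simp only [latticePt, Matrix.cons_val] at a0 a1 a2 b0 b1 b2
  by_contra! hlt
  have hlq : l ^ 2 * Real.exp q < 1 / 7 := by
    calc l ^ 2 * Real.exp q < Real.exp (-(q / 2) - 1) ^ 2 * Real.exp q := by gcongr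
      _ = (Real.exp 2)⁻¹ := by
        rw [← Real.exp_nat_mul, ← Real.exp_add, ← Real.exp_neg]
        congr 1
        push_cast
        ring
      _ ≤ 1 / 7 := by rw [one_div]; exact inv_anti₀ (by norm_num) seven_le_exp_two
  have hE : Real.exp (2 * q) * Real.exp (-q) = Real.exp q := by
    rw [← Real.exp_add]; congr 1; ring
  have minor : ∀ (ζ : ℝ) (m m' : ℤ), |ζ * x - m| ≤ l * Real.exp (-q) →
      |ζ * x' - m'| ≤ l * Real.exp (-q) → x' * m - x * m' = 0 := by
    intro ζ m m' h h'
    by_contra hne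
    have h1 := one_le_abs_intCast hne
    have h2 : ((x' * m - x * m' : ℤ) : ℝ) = x * (ζ * x' - m') - x' * (ζ * x - m) := by
      push_cast; ring
    rw [h2] at h1
    have h3 : |(x : ℝ) * (ζ * x' - m')| ≤ (l * Real.exp (2 * q)) * (l * Real.exp (-q)) := by
      rw [abs_mul]; gcongr
    have h4 : |(x' : ℝ) * (ζ * x - m)| ≤ (l * Real.exp (2 * q)) * (l * Real.exp (-q)) := by
      rw [abs_mul]; gcongr
    have h5 : (l * Real.exp (2 * q)) * (l * Real.exp (-q)) = l ^ 2 * Real.exp q := by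
      rw [← hE]; ring
    have := abs_sub ((x : ℝ) * (ζ * x' - m')) (x' * (ζ * x - m))
    linarith
  have my := minor _ _ _ a1 b1
  have mz := minor _ _ _ a2 b2
  have hpair := LinearIndependent.pair_iff.1 (show LinearIndependent ℝ ![v 0, v 1] by
    convert hli using 1
    ext i : 1
    fin_cases i <;> rfl)
  have myr : (x' * y - x * y' : ℝ) = 0 := by exact_mod_cast my
  have mzr : (x' * z - x * z' : ℝ) = 0 := by exact_mod_cast mz
  have hx := (hpair x' (-x) (by
    rw [hu, hw]
    ext i
    fin_cases i <;> simp [latticePt] <;> linarith)).2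
  have hx0 : (x : ℝ) = 0 := by linarith
  have hsmall : l * Real.exp (-q) < 1 := by
    have h1 : Real.exp (-q) ≤ 1 := Real.exp_le_one_iff.2 (by linarith)
    have h2 : l < 1 := hlt.trans (by rw [Real.exp_lt_one_iff]; linarith)
    nlinarith
  rw [hx0, mul_zero, zero_sub, abs_neg] at a1 a2
  have hy0 : y = 0 := by
    by_contra hne
    linarith [one_le_abs_intCast hne]
  have hz0 : z = 0 := by
    by_contra hne
    linarith [one_le_abs_intCast hne]
  refine hli.ne_zero 0 ?_
  rw [hu, hy0, hz0]
  ext i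
  fin_cases i <;> simp [latticePt, hx0]

lemma neg_le_Lmin_one_of_triple (hq : 0 ≤ q) {v : Fin 3 → Fin 3 → ℝ}
    (hd : (Matrix.of v).det ≠ 0) (hv : ∀ i, v i ∈ LatticeSet ξ₁ ξ₂)
    (hb : ∀ i, InBox (Real.exp t) q (v i)) : -(2 * t) - 2 ≤ Lmin ξ₁ ξ₂ 1 q := by
  refine le_Lmin (by norm_num) hq fun l hl u hli hu hub => ?_
  obtain ⟨i, hi⟩ := exists_det_updateRow_ne_zero hd (hli.ne_zero 0)
  have h := one_le_of_det_ne_zero (ξ₁ := ξ₁) (ξ₂ := ξ₂) (q := q)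
    (l := Function.update (fun _ => Real.exp t) i l)
    (fun k => by
      rcases eq_or_ne k i with rfl | hk
      · simpa using hl
      · simpa [Function.update_of_ne hk] using Real.exp_pos t)
    (fun k => by
      rcases eq_or_ne k i with rfl | hk
      · simpa using hu 0
      · simpa [Function.update_of_ne hk] using hv k)
    (fun k => by
      rcases eq_or_ne k i with rfl | hk
      · simpa using hub 0
      · simpa [Function.update_of_ne hk] using hb k) hi
  have hprod : 1 ≤ 6 * (l * Real.exp t ^ 2) := by
    refine h.trans (le_of_eq ?_)
    fin_cases i <;> simp [Function.update] <;> ring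
  by_contra! hlt
  have : l * Real.exp t ^ 2 < 1 / 7 := by
    calc l * Real.exp t ^ 2 < Real.exp (-(2 * t) - 2) * Real.exp t ^ 2 := by gcongr
      _ = (Real.exp 2)⁻¹ := by
        rw [← Real.exp_nat_mul, ← Real.exp_add, ← Real.exp_neg]
        congr 1
        push_cast
        ring
      _ ≤ 1 / 7 := by rw [one_div]; exact inv_anti₀ (by norm_num) seven_le_exp_two
  linarith

end SuccessiveMinima

lemma limsup_eq_of_eventually_of_frequently {f : ℝ → ℝ} {c : ℝ}
    (h1 : ∀ ε > 0, ∀ᶠ q in atTop, f q ≤ c + ε) (h2 : ∀ ε > 0, ∃ᶠ q in atTop, c - ε ≤ f q) :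
    limsup f atTop = c := by
  apply le_antisymm
  · exact le_of_forall_pos_le_add fun ε hε =>
      limsup_le_of_le (IsCoboundedUnder.of_frequently_ge (h2 1 one_pos)) (h1 ε hε)
  · refine le_of_forall_pos_le_add fun ε hε => ?_
    have := le_limsup_of_frequently_le (h2 ε hε) (isBoundedUnder_of_eventually_le (h1 1 one_pos))
    linarith

lemma liminf_eq_of_eventually_of_frequently {f : ℝ → ℝ} {c : ℝ}
    (h1 : ∀ ε > 0, ∀ᶠ q in atTop, c - ε ≤ f q) (h2 : ∀ ε > 0, ∃ᶠ q in atTop, f q ≤ c + ε) :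
    liminf f atTop = c := by
  apply le_antisymm
  · exact le_of_forall_pos_le_add fun ε hε =>
      liminf_le_of_frequently_le (h2 ε hε) (isBoundedUnder_of_eventually_ge (h1 1 one_pos))
  · refine le_of_forall_pos_le_add fun ε hε => ?_
    have := le_liminf_of_le (IsCoboundedUnder.of_frequently_le (h2 1 one_pos)) (h1 ε hε)
    linarith

/-- The numerator of the partial sum `∑ k < n, 10 ^ (-(k + 1)!)` over the denominator `10 ^ n!`. -/
def liouvilleNumerator : ℕ → ℤ
  | 0 => 0
  | n + 1 => liouvilleNumerator n * 10 ^ (n * n.factorial) + 1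

lemma ten_pow_factorial_succ {R : Type*} [CommRing R] (n : ℕ) :
    (10 : R) ^ (n + 1).factorial = 10 ^ (n * n.factorial) * 10 ^ n.factorial := by
  rw [← pow_add, Nat.factorial_succ]; congr 1; ring

lemma isCoprime_liouvilleNumerator {n : ℕ} (hn : 1 ≤ n) :
    IsCoprime ((10 : ℤ) ^ n.factorial) (liouvilleNumerator n) := by
  apply IsCoprime.pow_left
  obtain ⟨m, rfl⟩ := Nat.exists_eq_succ_of_ne_zero (by omega : n ≠ 0)
  rcases Nat.eq_zero_or_pos m with rfl | hm
  · simp [liouvilleNumerator, isCoprime_one_right]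
  · have h0 : m * m.factorial ≠ 0 := (Nat.mul_pos hm m.factorial_pos).ne'
    obtain ⟨k, hk⟩ := Nat.exists_eq_succ_of_ne_zero h0
    exact ⟨-(liouvilleNumerator m * 10 ^ k), 1, by
      simp only [liouvilleNumerator, hk, Nat.succ_eq_add_one, pow_succ]; ring⟩

lemma liouvilleNumerator_div (n : ℕ) :
    (liouvilleNumerator n : ℝ) / 10 ^ n.factorial =
      ∑ k ∈ Finset.range n, (10 : ℝ) ^ (-((k + 1).factorial : ℤ)) := by
  induction n with
  | zero => simp [liouvilleNumerator]
  | succ n ih =>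
    rw [Finset.sum_range_succ, ← ih, liouvilleNumerator, zpow_neg, zpow_natCast,
      ten_pow_factorial_succ]
    push_cast
    field_simp

section Liouville

variable {ξ : ℝ} (hξ : ξ = ∑' k : ℕ, (10 : ℝ) ^ (-((k + 1).factorial : ℤ)))
include hξ

lemma sub_liouvilleNumerator_div (n : ℕ) :
    ξ - liouvilleNumerator n / 10 ^ n.factorial = LiouvilleNumber.remainder 10 n := by
  have hterm : ∀ k : ℕ, (10 : ℝ) ^ (-((k + 1).factorial : ℤ)) = 1 / 10 ^ (k + 1).factorial := by
    intro k
    rw [zpow_neg, zpow_natCast, one_div]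
  have hs : Summable fun k : ℕ => (10 : ℝ) ^ (-((k + 1).factorial : ℤ)) := by
    simp only [hterm]
    exact LiouvilleNumber.remainder_summable (by norm_num) 0
  rw [hξ, ← hs.sum_add_tsum_nat_add n, liouvilleNumerator_div, add_sub_cancel_left]
  exact tsum_congr fun i => hterm (i + n)

lemma sub_liouvilleNumerator_div_pos (n : ℕ) :
    0 < ξ - liouvilleNumerator n / 10 ^ n.factorial := by
  rw [sub_liouvilleNumerator_div hξ]
  exact LiouvilleNumber.remainder_pos (by norm_num) n

lemma sub_liouvilleNumerator_div_le (n : ℕ) :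
    ξ - liouvilleNumerator n / 10 ^ n.factorial ≤ 2 / 10 ^ (n + 1).factorial := by
  rw [sub_liouvilleNumerator_div hξ]
  refine (LiouvilleNumber.remainder_lt' n (by norm_num)).le.trans ?_
  rw [div_eq_mul_one_div 2]
  gcongr
  norm_num

lemma liouville_pos : 0 < ξ := by
  simpa [liouvilleNumerator] using sub_liouvilleNumerator_div_pos hξ 0

lemma liouville_lt_one : ξ < 1 := by
  have := sub_liouvilleNumerator_div_le hξ 1
  norm_num [liouvilleNumerator, Nat.factorial] at this
  linarith

lemma sq_sub_liouvilleNumerator_div_sq (n : ℕ) :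
    0 ≤ ξ ^ 2 - (liouvilleNumerator n / 10 ^ n.factorial) ^ 2 ∧
    ξ ^ 2 - (liouvilleNumerator n / 10 ^ n.factorial) ^ 2 ≤ 4 / 10 ^ (n + 1).factorial := by
  have h1 := sub_liouvilleNumerator_div_pos hξ n
  have h2 := sub_liouvilleNumerator_div_le hξ n
  have h3 := liouville_pos hξ
  have h4 := liouville_lt_one hξ
  have h5 : (0 : ℝ) ≤ liouvilleNumerator n / 10 ^ n.factorial := by
    rw [liouvilleNumerator_div]; positivity
  set r : ℝ := liouvilleNumerator n / 10 ^ n.factorial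
  have h6 : ξ ^ 2 - r ^ 2 = (ξ - r) * (ξ + r) := by ring
  have h7 : (4 : ℝ) / 10 ^ (n + 1).factorial = 2 / 10 ^ (n + 1).factorial * 2 := by ring
  rw [h6, h7]
  exact ⟨by positivity, by gcongr; linarith⟩

end Liouville

/-- The lattice point with first coordinate `10 ^ (2 * n!)`, close to both hyperplanes. -/
noncomputable def squarePt (ξ : ℝ) (n : ℕ) : Fin 3 → ℝ :=
  latticePt ξ (ξ ^ 2) ((10 ^ n.factorial) ^ 2) (10 ^ n.factorial * liouvilleNumerator n)
    (liouvilleNumerator n ^ 2)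

/-- The lattice point with first coordinate `10 ^ (n! + (n + 1)!)`. -/
noncomputable def mixedPt (ξ : ℝ) (n : ℕ) : Fin 3 → ℝ :=
  latticePt ξ (ξ ^ 2) (10 ^ n.factorial * 10 ^ (n + 1).factorial)
    (10 ^ n.factorial * liouvilleNumerator (n + 1))
    (10 ^ (n * n.factorial) * liouvilleNumerator n ^ 2 + 2 * liouvilleNumerator n)

lemma det_squarePt_mixedPt_squarePt (ξ : ℝ) (n : ℕ) :
    (Matrix.of ![squarePt ξ n, mixedPt ξ n, squarePt ξ (n + 1)]).det ≠ 0 := by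
  have h : (Matrix.of ![squarePt ξ n, mixedPt ξ n, squarePt ξ (n + 1)]).det =
      (10 ^ n.factorial) ^ 3 := by
    simp only [Matrix.det_fin_three, squarePt, mixedPt, latticePt, liouvilleNumerator,
      Matrix.of_apply, Matrix.cons_val]
    push_cast
    rw [ten_pow_factorial_succ]
    ring
  rw [h]
  positivity

/-- The exponent with `exp (logDenom n) = 10 ^ n!`. -/
noncomputable def logDenom (n : ℕ) : ℝ := n.factorial * Real.log 10

lemma exp_logDenom (n : ℕ) : Real.exp (logDenom n) = 10 ^ n.factorial := by
  rw [logDenom, Real.exp_nat_mul, Real.exp_log (by norm_num)]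

lemma logDenom_succ (n : ℕ) : logDenom (n + 1) = (n + 1) * logDenom n := by
  simp only [logDenom, Nat.factorial_succ]; push_cast; ring

lemma self_le_logDenom (n : ℕ) : (n : ℝ) ≤ logDenom n := by
  have h1 : (1 : ℝ) ≤ Real.log 10 := by
    rw [Real.le_log_iff_exp_le (by norm_num)]
    linarith [Real.exp_one_lt_d9]
  have h2 : (n : ℝ) ≤ n.factorial := by exact_mod_cast Nat.self_le_factorial n
  have h3 : (0 : ℝ) ≤ n.factorial := by positivity
  unfold logDenom
  nlinarith

lemma le_exp_of_le_mul {c s t : ℝ} (hc : c ≤ 7) {e : ℝ} (he : e ≤ c * Real.exp s)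
    (h : s + 2 ≤ t) : e ≤ Real.exp t := by
  calc e ≤ c * Real.exp s := he
    _ ≤ Real.exp 2 * Real.exp s := by gcongr; linarith [seven_le_exp_two]
    _ = Real.exp (s + 2) := by rw [← Real.exp_add, add_comm]
    _ ≤ Real.exp t := Real.exp_le_exp.2 h

section Liouville

variable {ξ : ℝ} (hξ : ξ = ∑' k : ℕ, (10 : ℝ) ^ (-((k + 1).factorial : ℤ)))
include hξ

lemma squarePt_inBox {n : ℕ} {q t : ℝ} (h0 : 2 * logDenom n ≤ t + 2 * q)
    (h1 : 2 - (n - 1) * logDenom n ≤ t - q) : InBox (Real.exp t) q (squarePt ξ n) := by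
  have hexp : (10 ^ n.factorial : ℝ) ^ 2 / 10 ^ (n + 1).factorial =
      Real.exp (-((n - 1) * logDenom n)) := by
    rw [← exp_logDenom, ← exp_logDenom, ← Real.exp_nat_mul, ← Real.exp_sub, logDenom_succ]
    congr 1
    push_cast
    ring
  have ha : (0 : ℝ) < 10 ^ n.factorial := by positivity
  have p1 := sub_liouvilleNumerator_div_pos hξ n
  have p2 := sub_liouvilleNumerator_div_le hξ n
  obtain ⟨p3, p4⟩ := sq_sub_liouvilleNumerator_div_sq hξ n
  have e1 : ξ * (10 ^ n.factorial) ^ 2 - 10 ^ n.factorial * liouvilleNumerator n =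
      (10 ^ n.factorial) ^ 2 * (ξ - liouvilleNumerator n / 10 ^ n.factorial) := by
    field_simp
  have e2 : ξ ^ 2 * (10 ^ n.factorial) ^ 2 - (liouvilleNumerator n : ℝ) ^ 2 =
      (10 ^ n.factorial) ^ 2 * (ξ ^ 2 - (liouvilleNumerator n / 10 ^ n.factorial) ^ 2) := by
    field_simp
  unfold InBox
  rw [← Real.exp_add, ← Real.exp_add]
  simp only [squarePt, latticePt, Matrix.cons_val]
  push_cast
  refine ⟨?_, ?_, ?_⟩
  · rw [abs_of_pos (by positivity), ← exp_logDenom, ← Real.exp_nat_mul]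
    exact Real.exp_le_exp.2 (by push_cast; linarith)
  · rw [e1, abs_of_nonneg (by positivity)]
    refine le_exp_of_le_mul (c := 2) (s := -((n - 1) * logDenom n)) (by norm_num) ?_ (by linarith)
    rw [← hexp]
    calc _ ≤ ((10 : ℝ) ^ n.factorial) ^ 2 * (2 / 10 ^ (n + 1).factorial) := by gcongr
      _ = _ := by ring
  · rw [e2, abs_of_nonneg (by positivity)]
    refine le_exp_of_le_mul (c := 4) (s := -((n - 1) * logDenom n)) (by norm_num) ?_ (by linarith)
    rw [← hexp]
    calc _ ≤ ((10 : ℝ) ^ n.factorial) ^ 2 * (4 / 10 ^ (n + 1).factorial) := by gcongr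
      _ = _ := by ring

lemma mixedPt_inBox {n : ℕ} {q t : ℝ} (h0 : (n + 2) * logDenom n ≤ t + 2 * q)
    (h1 : 2 - n * logDenom n ≤ t - q) : InBox (Real.exp t) q (mixedPt ξ n) := by
  have hexp : (10 ^ n.factorial : ℝ) / 10 ^ (n + 1).factorial =
      Real.exp (-(n * logDenom n)) := by
    rw [← exp_logDenom, ← exp_logDenom, ← Real.exp_sub, logDenom_succ]
    congr 1
    ring
  have ha : (0 : ℝ) < 10 ^ n.factorial := by positivity
  have ha' : (0 : ℝ) < 10 ^ (n + 1).factorial := by positivity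
  have p1 := sub_liouvilleNumerator_div_pos hξ (n + 1)
  have p2 := sub_liouvilleNumerator_div_le hξ (n + 1)
  obtain ⟨p3, p4⟩ := sq_sub_liouvilleNumerator_div_sq hξ (n + 1)
  have hsq : ((10 : ℝ) ^ (n + 1).factorial) ^ 2 ≤ 10 ^ (n + 1 + 1).factorial := by
    rw [← pow_mul]
    refine pow_le_pow_right₀ (by norm_num) ?_
    rw [Nat.factorial_succ (n + 1), mul_comm]
    exact Nat.mul_le_mul_right _ (by omega)
  have hdiv : ∀ c : ℝ, 0 ≤ c →
      10 ^ n.factorial * 10 ^ (n + 1).factorial * (c / 10 ^ (n + 1 + 1).factorial) ≤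
        c * Real.exp (-(n * logDenom n)) := by
    intro c hc
    rw [← hexp]
    calc (10 : ℝ) ^ n.factorial * 10 ^ (n + 1).factorial * (c / 10 ^ (n + 1 + 1).factorial)
        ≤ 10 ^ n.factorial * 10 ^ (n + 1).factorial * (c / (10 ^ (n + 1).factorial) ^ 2) := by
          gcongr
      _ = _ := by field_simp
  have e1 : ξ * (10 ^ n.factorial * 10 ^ (n + 1).factorial) -
      10 ^ n.factorial * liouvilleNumerator (n + 1) = 10 ^ n.factorial * 10 ^ (n + 1).factorial *
        (ξ - liouvilleNumerator (n + 1) / 10 ^ (n + 1).factorial) := by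
    field_simp
  have e2 : ξ ^ 2 * (10 ^ n.factorial * 10 ^ (n + 1).factorial) -
      (10 ^ (n * n.factorial) * (liouvilleNumerator n : ℝ) ^ 2 + 2 * liouvilleNumerator n) =
      10 ^ n.factorial * 10 ^ (n + 1).factorial *
        (ξ ^ 2 - (liouvilleNumerator (n + 1) / 10 ^ (n + 1).factorial) ^ 2) +
        10 ^ n.factorial / 10 ^ (n + 1).factorial := by
    simp only [liouvilleNumerator, ten_pow_factorial_succ]
    push_cast
    field_simp
    ring
  unfold InBox
  rw [← Real.exp_add, ← Real.exp_add]
  simp only [mixedPt, latticePt, Matrix.cons_val]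
  push_cast
  refine ⟨?_, ?_, ?_⟩
  · rw [abs_of_pos (by positivity), ← exp_logDenom, ← exp_logDenom, ← Real.exp_add, logDenom_succ]
    exact Real.exp_le_exp.2 (by linarith)
  · rw [e1, abs_of_nonneg (by positivity)]
    refine le_exp_of_le_mul (c := 2) (s := -(n * logDenom n)) (by norm_num) ?_ (by linarith)
    refine le_trans ?_ (hdiv 2 (by norm_num))
    gcongr
  · rw [e2, abs_of_nonneg (by positivity)]
    refine le_exp_of_le_mul (c := 5) (s := -(n * logDenom n)) (by norm_num) ?_ (by linarith)
    have := hdiv 4 (by norm_num)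
    rw [hexp]
    have h4 : (10 : ℝ) ^ n.factorial * 10 ^ (n + 1).factorial *
        (ξ ^ 2 - (liouvilleNumerator (n + 1) / 10 ^ (n + 1).factorial) ^ 2) ≤
        10 ^ n.factorial * 10 ^ (n + 1).factorial * (4 / 10 ^ (n + 1 + 1).factorial) := by
      gcongr
    linarith

/-- Short lattice points of small height are multiples of `squarePt ξ n`. -/
lemma exists_eq_smul_squarePt {n : ℕ} (hn : 1 ≤ n) {v : Fin 3 → ℝ}
    (hv : v ∈ LatticeSet ξ (ξ ^ 2))
    (h0 : 7 * (|v 0| * 10 ^ n.factorial) < 10 ^ (n + 1).factorial)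
    (h1 : 7 * (|v 1| * 10 ^ n.factorial) < 1) (h2 : 7 * (|v 2| * 10 ^ n.factorial) < 1) :
    ∃ k : ℝ, v = k • squarePt ξ n := by
  obtain ⟨x, y, z, rfl⟩ := exists_eq_latticePt hv
  simp only [latticePt, Matrix.cons_val] at h0 h1 h2
  have hcop := isCoprime_liouvilleNumerator hn
  have p1 := sub_liouvilleNumerator_div_pos hξ n
  have p2 := sub_liouvilleNumerator_div_le hξ n
  obtain ⟨p3, p4⟩ := sq_sub_liouvilleNumerator_div_sq hξ n
  have ha : (0 : ℝ) < 10 ^ n.factorial := by positivity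
  have ha' : (0 : ℝ) < 10 ^ (n + 1).factorial := by positivity
  have haz : ((10 : ℤ) ^ n.factorial) ≠ 0 := by positivity
  have herr : ∀ c d : ℝ, 0 ≤ c → 0 ≤ d → d ≤ c / 10 ^ (n + 1).factorial →
      |10 ^ n.factorial * (x * d)| ≤ c / 7 := by
    intro c d hc hd hle
    rw [abs_mul, abs_mul, abs_of_pos ha, abs_of_nonneg hd]
    calc _ ≤ 10 ^ n.factorial * (|(x : ℝ)| * (c / 10 ^ (n + 1).factorial)) := by gcongr
      _ = c / 7 * (7 * (|(x : ℝ)| * 10 ^ n.factorial) / 10 ^ (n + 1).factorial) := by ring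
      _ ≤ c / 7 * 1 := by
        gcongr
        rw [div_le_one ha']
        exact h0.le
      _ = c / 7 := mul_one _
  have hy : x * liouvilleNumerator n - 10 ^ n.factorial * y = 0 := by
    by_contra hne
    have hge := one_le_abs_intCast hne
    have heq : ((x * liouvilleNumerator n - 10 ^ n.factorial * y : ℤ) : ℝ) =
        10 ^ n.factorial * (ξ * x - y) -
          10 ^ n.factorial * (x * (ξ - liouvilleNumerator n / 10 ^ n.factorial)) := by
      push_cast
      field_simp
      ring
    rw [heq] at hge
    have t1 := herr 2 _ (by norm_num) p1.le p2
    have t2 := abs_sub ((10 : ℝ) ^ n.factorial * (ξ * x - y))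
      (10 ^ n.factorial * (x * (ξ - liouvilleNumerator n / 10 ^ n.factorial)))
    rw [abs_mul _ (ξ * x - y), abs_of_pos ha] at t2
    linarith
  obtain ⟨m, rfl⟩ : (10 : ℤ) ^ n.factorial ∣ x :=
    hcop.dvd_of_dvd_mul_right ⟨y, by linarith⟩
  have hym : y = m * liouvilleNumerator n := by
    apply mul_left_cancel₀ haz
    linarith
  have hz : m * liouvilleNumerator n ^ 2 - 10 ^ n.factorial * z = 0 := by
    by_contra hne
    have hge := one_le_abs_intCast hne
    have heq : ((m * liouvilleNumerator n ^ 2 - 10 ^ n.factorial * z : ℤ) : ℝ) =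
        10 ^ n.factorial * (ξ ^ 2 * ((10 ^ n.factorial * m : ℤ) : ℝ) - z) -
          10 ^ n.factorial * (((10 ^ n.factorial * m : ℤ) : ℝ) *
            (ξ ^ 2 - (liouvilleNumerator n / 10 ^ n.factorial) ^ 2)) := by
      push_cast
      field_simp
      ring
    rw [heq] at hge
    have t1 := herr 4 _ (by norm_num) p3 p4
    have t2 := abs_sub ((10 : ℝ) ^ n.factorial * (ξ ^ 2 * ((10 ^ n.factorial * m : ℤ) : ℝ) - z))
      (10 ^ n.factorial * (((10 ^ n.factorial * m : ℤ) : ℝ) *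
            (ξ ^ 2 - (liouvilleNumerator n / 10 ^ n.factorial) ^ 2)))
    rw [abs_mul _ (ξ ^ 2 * ((10 ^ n.factorial * m : ℤ) : ℝ) - z), abs_of_pos ha] at t2
    linarith
  obtain ⟨k, rfl⟩ : (10 : ℤ) ^ n.factorial ∣ m :=
    (hcop.pow_right (n := 2)).dvd_of_dvd_mul_right ⟨z, by linarith⟩
  have hzk : z = k * liouvilleNumerator n ^ 2 := by
    apply mul_left_cancel₀ haz
    linarith
  refine ⟨k, ?_⟩
  rw [hym, hzk]
  ext i
  fin_cases i <;> simp [squarePt, latticePt] <;> ring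

lemma le_Lmin_of_two_le {n j : ℕ} (hn : 1 ≤ n) (hj : 2 ≤ j) (hj3 : j ≤ 3) :
    (n + 1) * logDenom n / 3 - logDenom n - 2 ≤
      Lmin ξ (ξ ^ 2) j ((n + 1) * logDenom n / 3) := by
  have hA : 0 ≤ logDenom n := n.cast_nonneg.trans (self_le_logDenom n)
  refine le_Lmin hj3 (by positivity) fun l hl v hli hv hb => ?_
  by_contra! hlt
  set q := (n + 1) * logDenom n / 3 with hq
  have h7l : 7 * l < Real.exp (q - logDenom n) := by
    calc 7 * l < Real.exp 2 * Real.exp (q - logDenom n - 2) :=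
          mul_lt_mul' seven_le_exp_two hlt hl.le (Real.exp_pos 2)
      _ = _ := by rw [← Real.exp_add]; congr 1; ring
  have hmul : ∀ i, ∃ k : ℝ, v i = k • squarePt ξ n := by
    intro i
    obtain ⟨b0, b1, b2⟩ := hb i
    have hsmall : ∀ w : ℝ, |w| ≤ l * Real.exp (-q) → 7 * (|w| * 10 ^ n.factorial) < 1 := by
      intro w hw
      rw [← exp_logDenom]
      calc 7 * (|w| * Real.exp (logDenom n))
          ≤ 7 * (l * Real.exp (-q) * Real.exp (logDenom n)) := by gcongr
        _ = (7 * l) * Real.exp (-q + logDenom n) := by rw [Real.exp_add]; ring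
        _ < Real.exp (q - logDenom n) * Real.exp (-q + logDenom n) := by gcongr
        _ = 1 := by rw [← Real.exp_add]; simp
    refine exists_eq_smul_squarePt hξ hn (hv i) ?_ (hsmall _ b1) (hsmall _ b2)
    rw [← exp_logDenom, ← exp_logDenom]
    calc 7 * (|v i 0| * Real.exp (logDenom n))
        ≤ 7 * (l * Real.exp (2 * q) * Real.exp (logDenom n)) := by gcongr
      _ = (7 * l) * Real.exp (2 * q + logDenom n) := by rw [Real.exp_add]; ring
      _ < Real.exp (q - logDenom n) * Real.exp (2 * q + logDenom n) := by gcongr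
      _ = Real.exp (logDenom (n + 1)) := by
        rw [← Real.exp_add, logDenom_succ, hq]; congr 1; ring
  let i₀ : Fin j := ⟨0, by omega⟩
  let i₁ : Fin j := ⟨1, by omega⟩
  obtain ⟨k₀, hk₀⟩ := hmul i₀
  obtain ⟨k₁, hk₁⟩ := hmul i₁
  have hinj : Function.Injective ![i₀, i₁] := by
    intro a b hab
    fin_cases a <;> fin_cases b <;> simp_all [i₀, i₁]
  have hpair := LinearIndependent.pair_iff.1 (show LinearIndependent ℝ ![v i₀, v i₁] by
    convert hli.comp _ hinj using 1
    ext i : 1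
    fin_cases i <;> rfl)
  have := (hpair k₁ (-k₀) (by rw [hk₀, hk₁, smul_smul, smul_smul, ← add_smul]; ring_nf; simp)).2
  refine hli.ne_zero i₀ ?_
  rw [hk₀, neg_eq_zero.1 this, zero_smul]

end Liouville

lemma frequently_of_le_seq {u : ℕ → ℝ} (hu : ∀ n : ℕ, (n : ℝ) / 3 ≤ u n) {P : ℝ → Prop} {ε : ℝ}
    (hε : 0 < ε) (h : ∀ n : ℕ, 4 ≤ n → 12 ≤ ε * n → P (u n)) : ∃ᶠ q in atTop, P q := by
  have ht : Tendsto u atTop atTop := tendsto_atTop_mono hu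
    (tendsto_natCast_atTop_atTop.atTop_div_const (by norm_num))
  refine ht.frequently (Eventually.frequently ?_)
  have hlim : Tendsto (fun n : ℕ => ε * (n : ℝ)) atTop atTop :=
    tendsto_natCast_atTop_atTop.const_mul_atTop hε
  filter_upwards [eventually_ge_atTop 4, hlim.eventually_ge_atTop 12] with n h4 h12
  exact h n h4 h12

lemma div_three_le_succ_mul_logDenom (n : ℕ) : (n : ℝ) / 3 ≤ (n + 1) * logDenom n / 3 := by
  have h := self_le_logDenom n
  have hn : (0 : ℝ) ≤ n := n.cast_nonneg
  nlinarith

lemma exists_logDenom_le_lt {N : ℕ} {q : ℝ} (h : logDenom N ≤ q) :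
    ∃ n, N ≤ n ∧ logDenom n ≤ q ∧ q < logDenom (n + 1) := by
  by_contra! hc
  have hall : ∀ n, N ≤ n → logDenom n ≤ q := fun n hn =>
    Nat.le_induction h (fun k hk ih => hc k hk ih) n hn
  obtain ⟨m, hm⟩ := exists_nat_gt q
  have h1 := hall (max N m) (le_max_left _ _)
  have h2 := self_le_logDenom (max N m)
  have h3 : (m : ℝ) ≤ (max N m : ℕ) := by exact_mod_cast le_max_right N m
  linarith

lemma triple_mem_LatticeSet (ξ : ℝ) (n : ℕ) (i : Fin 3) :
    ![squarePt ξ n, mixedPt ξ n, squarePt ξ (n + 1)] i ∈ LatticeSet ξ (ξ ^ 2) := by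
  fin_cases i <;> exact latticePt_mem _ _ _ _ _

lemma div_three_le_mul_logDenom (n : ℕ) : (n : ℝ) / 3 ≤ n * logDenom n := by
  have := self_le_logDenom n
  rcases Nat.eq_zero_or_pos n with rfl | hn
  · simp
  · have hn : (1 : ℝ) ≤ n := by exact_mod_cast hn
    nlinarith

section Liouville

variable {ξ : ℝ} (hξ : ξ = ∑' k : ℕ, (10 : ℝ) ^ (-((k + 1).factorial : ℤ)))
include hξ

lemma Lmin_one_le {n : ℕ} {q t : ℝ} (hq : 0 ≤ q) (h0 : 2 * logDenom n ≤ t + 2 * q)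
    (h1 : 2 - (n - 1) * logDenom n ≤ t - q) : Lmin ξ (ξ ^ 2) 1 q ≤ t :=
  Lmin_le_of_triple le_rfl (by norm_num) hq (det_squarePt_mixedPt_squarePt ξ n)
    (triple_mem_LatticeSet ξ n) fun i => by
      fin_cases i
      exact squarePt_inBox hξ h0 h1

lemma Lmin_two_le {n : ℕ} (hn : 1 ≤ n) : Lmin ξ (ξ ^ 2) 2 ((2 * n + 1) * logDenom n / 3) ≤
    (4 - n) * logDenom n / 3 + 2 := by
  have hn' : (1 : ℝ) ≤ n := by exact_mod_cast hn
  have hA := hn'.trans (self_le_logDenom n)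
  refine Lmin_le_of_triple (by norm_num) (by norm_num) (by positivity)
    (det_squarePt_mixedPt_squarePt ξ n) (triple_mem_LatticeSet ξ n) fun i => ?_
  fin_cases i
  · exact squarePt_inBox hξ (by nlinarith) (by nlinarith)
  · exact mixedPt_inBox hξ (by nlinarith) (by nlinarith)

lemma triple_inBox {n : ℕ} (hn : 2 ≤ n) (i : Fin 3) :
    InBox (Real.exp (2 * logDenom n + 2)) (n * logDenom n)
      (![squarePt ξ n, mixedPt ξ n, squarePt ξ (n + 1)] i) := by
  have hn' : (2 : ℝ) ≤ n := by exact_mod_cast hn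
  have hA := hn'.trans (self_le_logDenom n)
  fin_cases i
  · exact squarePt_inBox hξ (by nlinarith) (by nlinarith)
  · exact mixedPt_inBox hξ (by nlinarith) (by nlinarith)
  · refine squarePt_inBox hξ ?_ ?_ <;> rw [logDenom_succ] <;> push_cast <;>
      nlinarith [mul_nonneg (mul_nonneg n.cast_nonneg n.cast_nonneg : (0 : ℝ) ≤ n * n)
        (show 0 ≤ logDenom n by linarith)]

lemma phiLow_one : phiLow ξ (ξ ^ 2) 1 = -2 := by
  refine liminf_eq_of_eventually_of_frequently (fun ε hε => ?_) fun ε hε => ?_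
  · filter_upwards [eventually_gt_atTop 0] with q hq
    rw [le_div_iff₀ hq]
    have := neg_two_mul_le_Lmin_one (ξ₁ := ξ) (ξ₂ := ξ ^ 2) hq.le
    nlinarith
  · refine frequently_of_le_seq div_three_le_succ_mul_logDenom hε fun n h4 h12 => ?_
    have hn : (4 : ℝ) ≤ n := by exact_mod_cast h4
    have hA := hn.trans (self_le_logDenom n)
    have hq : 0 < (n + 1) * logDenom n / 3 := by positivity
    rw [div_le_iff₀ hq]
    have := Lmin_one_le hξ (n := n) (q := (n + 1) * logDenom n / 3)
      (t := 2 * logDenom n - 2 * ((n + 1) * logDenom n / 3) + 2) hq.le (by linarith) (by linarith)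
    nlinarith

lemma phiLow_two : phiLow ξ (ξ ^ 2) 2 = -(1 / 2) := by
  refine liminf_eq_of_eventually_of_frequently (fun ε hε => ?_) fun ε hε => ?_
  · filter_upwards [eventually_gt_atTop 0, eventually_ge_atTop (1 / ε)] with q hq hq'
    rw [le_div_iff₀ hq]
    rw [div_le_iff₀ hε] at hq'
    have := neg_half_le_Lmin_two (ξ₁ := ξ) (ξ₂ := ξ ^ 2) hq.le
    nlinarith
  · refine frequently_of_le_seq (u := fun n => (2 * n + 1) * logDenom n / 3)
      (fun n => (div_three_le_succ_mul_logDenom n).trans ?_) hε fun n h4 h12 => ?_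
    · have := n.cast_nonneg.trans (self_le_logDenom n)
      have hn : (0 : ℝ) ≤ n := n.cast_nonneg
      gcongr
      linarith
    have hn : (4 : ℝ) ≤ n := by exact_mod_cast h4
    have hA := hn.trans (self_le_logDenom n)
    rw [div_le_iff₀ (by positivity)]
    have := Lmin_two_le hξ (n := n) (by omega)
    nlinarith

lemma phiLow_three : phiLow ξ (ξ ^ 2) 3 = 0 := by
  refine liminf_eq_of_eventually_of_frequently (fun ε hε => ?_) fun ε hε => ?_
  · filter_upwards [eventually_gt_atTop 0, eventually_ge_atTop (2 / ε)] with q hq hq'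
    rw [le_div_iff₀ hq]
    rw [div_le_iff₀ hε] at hq'
    have := neg_two_le_Lmin_three (ξ₁ := ξ) (ξ₂ := ξ ^ 2) hq.le
    nlinarith
  · refine frequently_of_le_seq div_three_le_mul_logDenom hε fun n h4 h12 => ?_
    have hn : (4 : ℝ) ≤ n := by exact_mod_cast h4
    have hA := hn.trans (self_le_logDenom n)
    have hq : 0 < n * logDenom n := by positivity
    rw [div_le_iff₀ hq]
    have := Lmin_le_of_triple (j := 3) (by norm_num) le_rfl hq.le
      (det_squarePt_mixedPt_squarePt ξ n) (triple_mem_LatticeSet ξ n)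
      fun _ => triple_inBox hξ (by omega) _
    nlinarith

lemma phiUp_one : phiUp ξ (ξ ^ 2) 1 = 0 := by
  refine limsup_eq_of_eventually_of_frequently (fun ε hε => ?_) fun ε hε => ?_
  · obtain ⟨N, hN⟩ := exists_nat_ge (4 / ε)
    filter_upwards [eventually_gt_atTop 0, eventually_ge_atTop (4 / ε),
      eventually_ge_atTop (logDenom (N + 1))] with q hq hqε hqN
    obtain ⟨n, hn, hle, hlt⟩ := exists_logDenom_le_lt hqN
    have hn1 : (1 : ℝ) ≤ n := by exact_mod_cast (by omega : 1 ≤ n)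
    have hNn : (N : ℝ) ≤ n := by exact_mod_cast (by omega : N ≤ n)
    rw [logDenom_succ] at hlt
    have hmul : 2 * q / (n + 1) * (n + 1) = 2 * q := by field_simp
    have hpos : 0 ≤ 2 * q / (n + 1) := by positivity
    have hbound := Lmin_one_le hξ (n := n) (q := q) (t := 2 * q / (n + 1) + 2) hq.le
      (by linarith) (by
        have h1 : q / (n + 1) ≤ logDenom n := by rw [div_le_iff₀ (by linarith)]; linarith
        have h2 : 2 * q / (n + 1) - q = -((n - 1) * (q / (n + 1))) := by field_simp; ring
        have h3 : (n - 1) * (q / (n + 1)) ≤ (n - 1) * logDenom n :=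
          mul_le_mul_of_nonneg_left h1 (by linarith)
        linarith)
    rw [div_le_iff₀ hq]
    rw [div_le_iff₀ hε] at hqε hN
    have h4 : 2 * q / (n + 1) ≤ ε / 2 * q := by
      rw [div_le_iff₀ (by linarith)]
      have : 4 ≤ ε * (n + 1) := by nlinarith
      nlinarith
    linarith
  · refine frequently_of_le_seq div_three_le_mul_logDenom hε fun n h4 h12 => ?_
    have hn : (4 : ℝ) ≤ n := by exact_mod_cast h4
    have hA := hn.trans (self_le_logDenom n)
    have hq : 0 < n * logDenom n := by positivity
    rw [le_div_iff₀ hq]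
    have := neg_le_Lmin_one_of_triple hq.le (det_squarePt_mixedPt_squarePt ξ n)
      (triple_mem_LatticeSet ξ n) (triple_inBox hξ (by omega))
    nlinarith

lemma phiUp_eq_one {j : ℕ} (hj : 2 ≤ j) (hj3 : j ≤ 3) : phiUp ξ (ξ ^ 2) j = 1 := by
  refine limsup_eq_of_eventually_of_frequently (fun ε hε => ?_) fun ε hε => ?_
  · filter_upwards [eventually_gt_atTop 0] with q hq
    rw [div_le_iff₀ hq]
    have := Lmin_le_self (ξ₁ := ξ) (ξ₂ := ξ ^ 2) (by omega : 1 ≤ j) hj3 hq.le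
    nlinarith
  · refine frequently_of_le_seq div_three_le_succ_mul_logDenom hε fun n h4 h12 => ?_
    have hn : (4 : ℝ) ≤ n := by exact_mod_cast h4
    have hA := hn.trans (self_le_logDenom n)
    rw [le_div_iff₀ (by positivity)]
    have := le_Lmin_of_two_le hξ (n := n) (by omega) hj hj3
    nlinarith

end Liouville

/-- For Liouville's constant `ξ = Σ_{k≥1} 10^{-k!}`, the pair `(ξ, ξ²)` satisfies
`φ̲₁ = -2`, `φ̲₂ = -1/2`, `φ̲₃ = 0`, `φ̄₁ = 0`, `φ̄₂ = 1`, `φ̄₃ = 1`. -/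
theorem phi_of_liouville_constant_pair
    (ξ : ℝ) (hξ : ξ = ∑' k : ℕ, (10 : ℝ) ^ (-((k + 1).factorial : ℤ))) :
    phiLow ξ (ξ ^ 2) 1 = -2 ∧ phiLow ξ (ξ ^ 2) 2 = -(1 / 2) ∧ phiLow ξ (ξ ^ 2) 3 = 0 ∧
    phiUp ξ (ξ ^ 2) 1 = 0 ∧ phiUp ξ (ξ ^ 2) 2 = 1 ∧ phiUp ξ (ξ ^ 2) 3 = 1 := by
  exact ⟨phiLow_one hξ, phiLow_two hξ, phiLow_three hξ, phiUp_one hξ,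
    phiUp_eq_one hξ le_rfl (by norm_num), phiUp_eq_one hξ (by norm_num) le_rfl⟩
end

section
/- Let ξ₁, ξ₂ be real numbers such that {1, ξ₁, ξ₂} is linearly independent over ℚ and such that ξ₁, ξ₂ are simultaneously approximable to any order, i.e. for every w > 0 there exist infinitely many positive integers x admitting integers y₁, y₂ with max(|ξ₁x − y₁|, |ξ₂x − y₂|) ≤ x^{−w}. Then φ̄₃ = 1. -/
open Filter Pointwise

/-- If `|A i j| ≤ r i * a j` for all `i, j`, then `|det A| ≤ n! * (∏ r i) * (∏ a j)`. -/
theorem Matrix.abs_det_le_factorial_mul_prod {n : Type*} [Fintype n] [DecidableEq n]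
    (A : Matrix n n ℝ) (r a : n → ℝ) (h : ∀ i j, |A i j| ≤ r i * a j) :
    |A.det| ≤ (Fintype.card n).factorial * ((∏ i, r i) * ∏ j, a j) := by
  rw [Matrix.det_apply']
  have key : ∀ σ ∈ (Finset.univ : Finset (Equiv.Perm n)),
      |((Equiv.Perm.sign σ : ℤ) : ℝ) * ∏ i, A (σ i) i| ≤ (∏ i, r i) * ∏ j, a j := by
    intro σ _
    have hs : |((Equiv.Perm.sign σ : ℤ) : ℝ)| = 1 := by
      rcases Int.units_eq_one_or (Equiv.Perm.sign σ) with hσ | hσ <;> simp [hσ]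
    rw [abs_mul, hs, one_mul, Finset.abs_prod, ← Equiv.prod_comp σ r, ← Finset.prod_mul_distrib]
    exact Finset.prod_le_prod (fun _ _ => abs_nonneg _) fun i _ => h _ _
  refine (Finset.abs_sum_le_sum_abs _ _).trans ((Finset.sum_le_sum key).trans_eq ?_)
  simp [Fintype.card_perm]

/-- Replacing a suitable row of an invertible matrix by a nonzero vector keeps it invertible. -/
theorem Matrix.exists_det_updateRow_ne_zero {n K : Type*} [Fintype n] [DecidableEq n] [Field K]
    {A : Matrix n n K} (hA : A.det ≠ 0) {p : n → K} (hp : p ≠ 0) :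
    ∃ k, (A.updateRow k p).det ≠ 0 := by
  by_contra! h
  have hz : A.transpose.cramer p = 0 := by
    ext k
    rw [Matrix.cramer_transpose_apply, h k, Pi.zero_apply]
  have := Matrix.mulVec_cramer A.transpose p
  rw [hz, Matrix.mulVec_zero, Matrix.det_transpose] at this
  exact (smul_ne_zero hA hp) this.symm

/-- The lattice `Λ` has covolume one: nonzero determinants of lattice points are at least one. -/
theorem one_le_abs_det_of_mem_latticeSet {ξ₁ ξ₂ : ℝ} {A : Matrix (Fin 3) (Fin 3) ℝ}
    (hA : ∀ i, A i ∈ LatticeSet ξ₁ ξ₂) (hdet : A.det ≠ 0) : 1 ≤ |A.det| := by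
  choose x y z h0 h1 h2 using hA
  have hd : A.det = ((Matrix.of fun i => ![x i, -y i, -z i]).det : ℤ) := by
    rw [Matrix.det_fin_three, Matrix.det_fin_three]
    simp only [h0, h1, h2, Matrix.of_apply, Matrix.cons_val]
    push_cast
    ring
  rw [hd] at hdet ⊢
  exact_mod_cast Int.one_le_abs (by exact_mod_cast hdet)

theorem mem_smul_box_iff {l q : ℝ} (hl : 0 < l) {z : Fin 3 → ℝ} :
    z ∈ l • Box q ↔ ∀ j, |z j| ≤
      l * ![Real.exp (2 * q), Real.exp (-q), Real.exp (-q)] j := by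
  rw [Set.mem_smul_set_iff_inv_smul_mem₀ hl.ne', Fin.forall_fin_succ, Fin.forall_fin_succ,
    Fin.forall_fin_succ]
  simp [Box, abs_mul, abs_of_pos hl, inv_mul_le_iff₀ hl]

theorem prod_box_sides (q : ℝ) :
    ∏ j, ![Real.exp (2 * q), Real.exp (-q), Real.exp (-q)] j = 1 := by
  simp only [Fin.prod_univ_three, Matrix.cons_val]
  rw [← Real.exp_add, ← Real.exp_add, Real.exp_eq_one_iff]
  ring

/-- A nonzero lattice point in `μ • K(q)` forces the third minimum `l` to satisfy
`1 ≤ 6 μ l²`. -/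
theorem one_le_mul_sq_of_linearIndependent {ξ₁ ξ₂ q l μ : ℝ} (hl : 0 < l) (hμ : 0 < μ)
    {p : Fin 3 → ℝ} (hp : p ∈ LatticeSet ξ₁ ξ₂) (hp0 : p ≠ 0) (hpμ : p ∈ μ • Box q)
    {v : Fin 3 → Fin 3 → ℝ} (hv : LinearIndependent ℝ v)
    (hvl : ∀ i, v i ∈ LatticeSet ξ₁ ξ₂ ∧ v i ∈ l • Box q) : 1 ≤ 6 * (μ * l ^ 2) := by
  have hdet : (Matrix.of v).det ≠ 0 :=
    ((Matrix.isUnit_iff_isUnit_det _).1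
      (Matrix.linearIndependent_rows_iff_isUnit.1 hv)).ne_zero
  obtain ⟨k, hk⟩ := Matrix.exists_det_updateRow_ne_zero hdet hp0
  have hone : 1 ≤ |((Matrix.of v).updateRow k p).det| := by
    refine one_le_abs_det_of_mem_latticeSet (ξ₁ := ξ₁) (ξ₂ := ξ₂) (fun i => ?_) hk
    by_cases hi : i = k
    · subst hi
      rwa [Matrix.updateRow_self]
    · rw [Matrix.updateRow_ne hi]
      exact (hvl i).1
  have hle := Matrix.abs_det_le_factorial_mul_prod ((Matrix.of v).updateRow k p)
    (Function.update (fun _ => l) k μ) ![Real.exp (2 * q), Real.exp (-q), Real.exp (-q)]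
    (fun i j => by
      by_cases hi : i = k
      · subst hi
        rw [Matrix.updateRow_self, Function.update_self]
        exact (mem_smul_box_iff hμ).1 hpμ j
      · rw [Matrix.updateRow_ne hi, Function.update_of_ne hi]
        exact (mem_smul_box_iff hl).1 (hvl i).2 j)
  rw [prod_box_sides, Finset.prod_update_of_mem (Finset.mem_univ k)] at hle
  have hcard : (Finset.univ \ {k} : Finset (Fin 3)).card = 2 := by
    rw [Finset.card_sdiff_of_subset (Finset.subset_univ _)]
    simp
  rw [Finset.prod_const, hcard] at hle
  simp only [Fintype.card_fin, mul_one] at hle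
  norm_num [Nat.factorial] at hle
  exact hone.trans hle

theorem exp_mem_lambdaMin_three (ξ₁ ξ₂ : ℝ) {q : ℝ} (hq : 0 ≤ q) :
    Real.exp q ∈ {l : ℝ | 0 < l ∧ ∃ v : Fin 3 → (Fin 3 → ℝ), LinearIndependent ℝ v ∧
      ∀ i, v i ∈ LatticeSet ξ₁ ξ₂ ∧ v i ∈ l • Box q} := by
  refine ⟨Real.exp_pos q, ![![1, Int.fract ξ₁, Int.fract ξ₂], ![0, 1, 0], ![0, 0, 1]], ?_, ?_⟩
  · refine (Matrix.linearIndependent_rows_iff_isUnit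
      (A := Matrix.of ![![1, Int.fract ξ₁, Int.fract ξ₂], ![0, 1, 0], ![0, 0, 1]])).2 ?_
    rw [Matrix.isUnit_iff_isUnit_det, Matrix.det_fin_three]
    simp
  · have h1 : Real.exp q * Real.exp (-q) = 1 := by rw [← Real.exp_add]; simp
    have h2 : 1 ≤ Real.exp q * Real.exp (2 * q) := by
      rw [← Real.exp_add]
      exact Real.one_le_exp (by linarith)
    have h3 : 0 ≤ Real.exp q * Real.exp (2 * q) := by positivity
    intro i
    rw [mem_smul_box_iff (Real.exp_pos q)]
    fin_cases i
    · refine ⟨⟨1, ⌊ξ₁⌋, ⌊ξ₂⌋, by simp, by simp, by simp⟩, fun j => ?_⟩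
      fin_cases j <;> simp [h1, h2, abs_of_nonneg, Int.fract_nonneg, (Int.fract_lt_one _).le]
    · refine ⟨⟨0, -1, 0, by simp, by simp, by simp⟩, fun j => ?_⟩
      fin_cases j <;> simp [h1, h3]
    · refine ⟨⟨0, 0, -1, by simp, by simp, by simp⟩, fun j => ?_⟩
      fin_cases j <;> simp [h1, h3]

theorem Lmin_three_le (ξ₁ ξ₂ : ℝ) {q : ℝ} (hq : 0 ≤ q) : Lmin ξ₁ ξ₂ 3 q ≤ q := by
  have h0 : 0 ≤ lambdaMin ξ₁ ξ₂ 3 q := Real.sInf_nonneg fun l hl => hl.1.le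
  have h1 : lambdaMin ξ₁ ξ₂ 3 q ≤ Real.exp q :=
    csInf_le ⟨0, fun l hl => hl.1.le⟩ (exp_mem_lambdaMin_three ξ₁ ξ₂ hq)
  rcases h0.eq_or_lt with h | h
  · rw [Lmin, ← h, Real.log_zero]
    exact hq
  · exact (Real.log_le_iff_le_exp h).2 h1

/-- A nonzero lattice point in `μ • K(q)` gives `L₃(q) ≥ -(log 6 + log μ) / 2`. -/
theorem le_Lmin_three {ξ₁ ξ₂ q μ : ℝ} (hq : 0 ≤ q) (hμ : 0 < μ) {p : Fin 3 → ℝ}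
    (hp : p ∈ LatticeSet ξ₁ ξ₂) (hp0 : p ≠ 0) (hpμ : p ∈ μ • Box q) :
    -(Real.log 6 + Real.log μ) / 2 ≤ Lmin ξ₁ ξ₂ 3 q := by
  have hle : Real.exp (-(Real.log 6 + Real.log μ) / 2) ≤ lambdaMin ξ₁ ξ₂ 3 q := by
    refine le_csInf ⟨_, exp_mem_lambdaMin_three ξ₁ ξ₂ hq⟩ ?_
    rintro l ⟨hl, v, hv, hvl⟩
    have h := Real.log_nonneg (one_le_mul_sq_of_linearIndependent hl hμ hp hp0 hpμ hv hvl)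
    rw [Real.log_mul (by norm_num) (by positivity), Real.log_mul hμ.ne' (by positivity),
      Real.log_pow] at h
    rw [← Real.le_log_iff_exp_le hl]
    push_cast at h
    linarith
  exact (Real.le_log_iff_exp_le ((Real.exp_pos _).trans_le hle)).2 hle

theorem frequently_le_Lmin_three_div {ξ₁ ξ₂ : ℝ}
    (happrox : ∀ w : ℝ, 0 < w → ∀ N : ℕ, ∃ x : ℕ, N < x ∧
      ∃ y₁ y₂ : ℤ, max |ξ₁ * x - y₁| |ξ₂ * x - y₂| ≤ (x : ℝ) ^ (-w))
    {ε : ℝ} (hε : 0 < ε) : ∃ᶠ q in atTop, 1 - ε ≤ Lmin ξ₁ ξ₂ 3 q / q := by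
  rw [frequently_atTop]
  intro Q
  obtain ⟨N, hN⟩ := exists_nat_ge (Real.exp (max 3 Q) + 6)
  obtain ⟨x, hNx, y₁, y₂, hxy⟩ := happrox (3 / ε + 3) (by positivity) N
  have hNx' : (N : ℝ) < x := by exact_mod_cast hNx
  have hx6 : (6 : ℝ) ≤ x := by linarith [Real.exp_pos (max 3 Q)]
  have hx0 : (0 : ℝ) < x := by linarith
  have hlog : max 3 Q ≤ Real.log x := by
    rw [Real.le_log_iff_exp_le hx0]
    linarith
  have hlog3 := (le_max_left 3 Q).trans hlog
  have hlogQ := (le_max_right 3 Q).trans hlog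
  have hlog6 : Real.log 6 ≤ Real.log x := Real.log_le_log (by norm_num) hx6
  set t := Real.log x with ht
  set q := (3 / ε + 4) / 3 * t with hq
  have hqε : q * ε = t + 4 / 3 * (t * ε) := by rw [hq]; field_simp
  have htε : 0 < t * ε := by positivity
  have htq : t ≤ q := by
    have : 0 < 1 / ε * t := by positivity
    have : q = 1 / ε * t + 4 / 3 * t := by rw [hq]; ring
    linarith
  have hq0 : 0 < q := by linarith
  refine ⟨q, hlogQ.trans htq, ?_⟩
  have hxt : (x : ℝ) = Real.exp t := (Real.exp_log hx0).symm
  have hbd : (x : ℝ) ^ (-(3 / ε + 3)) = Real.exp (t - 2 * q) * Real.exp (-q) := by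
    rw [Real.rpow_def_of_pos hx0, ← Real.exp_add, ← ht, hq]
    ring_nf
  rw [hbd] at hxy
  have h := le_Lmin_three (ξ₁ := ξ₁) (ξ₂ := ξ₂) hq0.le (Real.exp_pos (t - 2 * q))
    (p := ![(x : ℝ), ξ₁ * x - y₁, ξ₂ * x - y₂])
    ⟨x, y₁, y₂, by simp, by simp, by simp⟩
    (fun h => hx0.ne' (by simpa using congrFun h 0))
    ((mem_smul_box_iff (Real.exp_pos _)).2 fun j => by
      fin_cases j
      · simp only [Fin.zero_eta, Matrix.cons_val_zero]
        rw [← Real.exp_add, abs_of_pos hx0, hxt]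
        simp
      · exact (le_max_left _ _).trans hxy
      · exact (le_max_right _ _).trans hxy)
  rw [Real.log_exp] at h
  rw [le_div_iff₀ hq0]
  linarith

/-- If `{1, ξ₁, ξ₂}` is linearly independent over `ℚ` and `ξ₁, ξ₂` are simultaneously
approximable to any order (for every `w > 0` there are infinitely many positive
integers `x` admitting integers `y₁, y₂` with `max(|ξ₁x - y₁|, |ξ₂x - y₂|) ≤ x^{-w}`),
then `φ̄₃ = 1`. -/
theorem phiUp_three_eq_one_of_very_well_approximable
    (ξ₁ ξ₂ : ℝ) (hind : LinearIndependent ℚ ![(1 : ℝ), ξ₁, ξ₂])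
    (happrox : ∀ w : ℝ, 0 < w → ∀ N : ℕ, ∃ x : ℕ, N < x ∧
      ∃ y₁ y₂ : ℤ, max |ξ₁ * x - y₁| |ξ₂ * x - y₂| ≤ (x : ℝ) ^ (-w)) :
    phiUp ξ₁ ξ₂ 3 = 1 := by
  have hle : ∀ᶠ q in atTop, Lmin ξ₁ ξ₂ 3 q / q ≤ 1 := by
    filter_upwards [eventually_gt_atTop 0] with q hq
    exact (div_le_one hq).2 (Lmin_three_le ξ₁ ξ₂ hq.le)
  refine le_antisymm (limsup_le_of_le ?_ hle) ?_
  · exact IsCoboundedUnder.of_frequently_ge (frequently_le_Lmin_three_div happrox one_pos)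
  · refine le_of_forall_pos_sub_le fun ε hε => ?_
    exact le_limsup_of_frequently_le (frequently_le_Lmin_three_div happrox hε) ⟨1, hle⟩
end
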